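/- arXiv:2110.06146 — 3 statements merged into one kernel-verified Lean document; each statement's English description precedes it below -/
import Mathlib

section
/- If G' is an induced subgraph of a graph G, then the twin-width of G' is at most the twin-width of G. -/
/-!
Twin-width, formalized via contraction sequences.

A sequence of `d`-contractions for a graph `G` is modeled by the sequence of
partitions of the vertex set of `G` whose parts are the sets of original
vertices merged (by the successive contractions) into a single vertex of the
current trigraph.  Under this correspondence, two distinct parts are joined by
a red edge precisely when they are "mixed" in `G` (neither completely adjacent
nor completely nonadjacent), and by a black edge when completely adjacent.
-/

/-- Parts `P` and `Q` form a red (mixed) pair with respect to `G`: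
neither complete nor anticomplete between them. -/
def SimpleGraph.MixedPair {V : Type*} (G : SimpleGraph V) (P Q : Set V) : Prop :=
  (¬ ∀ x ∈ P, ∀ y ∈ Q, G.Adj x y) ∧ (¬ ∀ x ∈ P, ∀ y ∈ Q, ¬ G.Adj x y)

/-- The red degree of the part `P` within the partition `parts`:
the number of other parts forming a red pair with `P`. -/
noncomputable def SimpleGraph.redDeg {V : Type*} (G : SimpleGraph V)
    (parts : Set (Set V)) (P : Set V) : ℕ :=
  {Q ∈ parts | Q ≠ P ∧ G.MixedPair P Q}.ncard

/-- `Q` is obtained from `P` by contracting (merging) two distinct parts. -/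
def TwwStep {V : Type*} (P Q : Set (Set V)) : Prop :=
  ∃ A ∈ P, ∃ B ∈ P, A ≠ B ∧ Q = insert (A ∪ B) (P \ {A, B})

/-- `G` admits a sequence of `d`-contractions: a contraction sequence leading from
the partition of the vertex set into singletons to the partition with the single
part `univ` (i.e. the one-vertex trigraph), in which every vertex of every
intermediate trigraph has red degree at most `d`. -/
def SimpleGraph.HasDSeq {V : Type*} (G : SimpleGraph V) (d : ℕ) : Prop :=
  ∃ (N : ℕ) (f : ℕ → Set (Set V)),
    f 0 = Set.range (fun v => ({v} : Set V)) ∧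
    (∀ i < N, TwwStep (f i) (f (i + 1))) ∧
    f N = {Set.univ} ∧
    ∀ i ≤ N, ∀ P ∈ f i, G.redDeg (f i) P ≤ d

/-- The twin-width of `G`: the least `d` such that `G` admits a `d`-sequence. -/
noncomputable def SimpleGraph.twinWidth {V : Type*} (G : SimpleGraph V) : ℕ :=
  sInf {d | G.HasDSeq d}

namespace SimpleGraph

variable {V : Type*}

/-- A contraction step whose resulting trigraph has red degree at most `d`. -/
def BoundedStep (G : SimpleGraph V) (d : ℕ) (P Q : Set (Set V)) : Prop :=
  TwwStep P Q ∧ ∀ X ∈ Q, G.redDeg Q X ≤ d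

/-- The traces on `s` of the members of `P` that meet `s`. -/
def traceParts (s : Set V) (P : Set (Set V)) : Set (Set s) :=
  {A | A.Nonempty ∧ ∃ X ∈ P, Subtype.val ⁻¹' X = A}

theorem reflTransGen_iff_exists_seq {α : Type*} {r : α → α → Prop} {a b : α} :
    Relation.ReflTransGen r a b ↔
      ∃ (N : ℕ) (f : ℕ → α), f 0 = a ∧ (∀ i < N, r (f i) (f (i + 1))) ∧ f N = b := by
  constructor
  · intro h
    induction h using Relation.ReflTransGen.head_induction_on with
    | refl => exact ⟨0, fun _ => b, rfl, by simp, rfl⟩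
    | @head a c hac _ ih =>
      obtain ⟨N, f, hf0, hf, hfN⟩ := ih
      refine ⟨N + 1, fun i => i.casesOn a f, rfl, fun i hi => ?_, hfN⟩
      cases i with
      | zero => simpa [hf0] using hac
      | succ i => exact hf i (by omega)
  · rintro ⟨N, f, rfl, hf, rfl⟩
    induction N with
    | zero => exact .refl
    | succ N ih => exact (ih fun i hi => hf i (by omega)).tail (hf N (by omega))

theorem not_mixedPair_singleton (G : SimpleGraph V) (v w : V) : ¬ G.MixedPair {v} {w} := by
  simp [MixedPair]

theorem redDeg_range_singleton (G : SimpleGraph V) (v : V) :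
    G.redDeg (Set.range fun v => ({v} : Set V)) {v} = 0 := by
  have : {Q ∈ Set.range fun v => ({v} : Set V) | Q ≠ {v} ∧ G.MixedPair {v} Q} = ∅ := by
    ext Q
    simp only [Set.mem_ofPred_eq, Set.mem_empty_iff_false, iff_false]
    rintro ⟨⟨w, rfl⟩, -, h⟩
    exact G.not_mixedPair_singleton v w h
  rw [redDeg, this, Set.ncard_empty]

theorem hasDSeq_iff_reflTransGen {G : SimpleGraph V} {d : ℕ} :
    G.HasDSeq d ↔ Relation.ReflTransGen (G.BoundedStep d)
      (Set.range fun v => ({v} : Set V)) {Set.univ} := by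
  rw [reflTransGen_iff_exists_seq]
  refine exists_congr fun N => exists_congr fun f => ?_
  constructor
  · rintro ⟨h0, hstep, hN, hd⟩
    exact ⟨h0, fun i hi => ⟨hstep i hi, hd (i + 1) hi⟩, hN⟩
  · rintro ⟨h0, hstep, hN⟩
    refine ⟨h0, fun i hi => (hstep i hi).1, hN, fun i hi => ?_⟩
    cases i with
    | zero =>
      rw [h0]
      rintro _ ⟨v, rfl⟩
      simp [redDeg_range_singleton]
    | succ i => exact (hstep i hi).2

theorem redDeg_traceParts_le [Finite V] (G : SimpleGraph V) (s : Set V) (P : Set (Set V))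
    (X : Set V) :
    (G.induce s).redDeg (traceParts s P) (Subtype.val ⁻¹' X) ≤ G.redDeg P X := by
  refine (Set.ncard_le_ncard (t := (Subtype.val ⁻¹' ·) '' {Q ∈ P | Q ≠ X ∧ G.MixedPair X Q}) ?_
    (Set.toFinite _)).trans (Set.ncard_image_le (Set.toFinite _))
  rintro _ ⟨⟨-, Y, hY, rfl⟩, hne, hmix⟩
  refine ⟨Y, ⟨hY, fun h => hne (by rw [h]), fun h => hmix.1 fun x hx y hy => h x hx y hy,
    fun h => hmix.2 fun x hx y hy => h x hx y hy⟩, rfl⟩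

theorem traceParts_range_singleton (s : Set V) :
    traceParts s (Set.range fun v => ({v} : Set V)) = Set.range fun v => ({v} : Set s) := by
  ext A
  constructor
  · rintro ⟨⟨x, hx⟩, _, ⟨v, rfl⟩, rfl⟩
    obtain rfl : (x : V) = v := hx
    exact ⟨x, by ext y; simp [Subtype.ext_iff]⟩
  · rintro ⟨v, rfl⟩
    exact ⟨Set.singleton_nonempty v, _, ⟨v, rfl⟩, by ext y; simp [Subtype.ext_iff]⟩

theorem traceParts_singleton_univ {s : Set V} (hs : s.Nonempty) :
    traceParts s {Set.univ} = {Set.univ} := by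
  have := hs.to_subtype
  ext A
  constructor
  · rintro ⟨-, _, rfl, rfl⟩
    rfl
  · rintro rfl
    exact ⟨Set.univ_nonempty, _, rfl, rfl⟩

theorem _root_.TwwStep.pairwiseDisjoint {P Q : Set (Set V)} (h : TwwStep P Q)
    (hP : P.PairwiseDisjoint id) : Q.PairwiseDisjoint id := by
  obtain ⟨A, hA, B, hB, -, rfl⟩ := h
  refine (hP.subset Set.sdiff_subset).insert fun C hC _ => ?_
  obtain ⟨hC, hCAB⟩ := hC
  simp only [Set.mem_insert_iff, Set.mem_singleton_iff, not_or] at hCAB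
  exact Set.disjoint_union_left.2 ⟨hP hA hC (Ne.symm hCAB.1), hP hB hC (Ne.symm hCAB.2)⟩

theorem _root_.TwwStep.traceParts {P Q : Set (Set V)} (h : TwwStep P Q)
    (hP : P.PairwiseDisjoint id) (s : Set V) :
    traceParts s Q = traceParts s P ∨ TwwStep (traceParts s P) (traceParts s Q) := by
  obtain ⟨A, hA, B, hB, hAB, rfl⟩ := h
  have eq_of_trace : ∀ X ∈ P, ∀ Y ∈ P, (Subtype.val ⁻¹' X : Set s).Nonempty →
      (Subtype.val ⁻¹' X : Set s) = Subtype.val ⁻¹' Y → X = Y := by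
    rintro X hX Y hY ⟨x, hx⟩ hXY
    exact hP.elim_set hX hY x hx (by rw [hXY] at hx; exact hx)
  rcases Set.eq_empty_or_nonempty (Subtype.val ⁻¹' A : Set s) with hA' | hA'
  · left
    ext C
    constructor
    · rintro ⟨hC, X, rfl | ⟨hX, -⟩, rfl⟩
      · exact ⟨hC, B, hB, by simp [hA']⟩
      · exact ⟨hC, X, hX, rfl⟩
    · rintro ⟨hC, X, hX, rfl⟩
      by_cases hXB : X = B
      · exact ⟨hC, _, .inl rfl, by simp [hA', hXB]⟩
      · refine ⟨hC, X, .inr ⟨hX, ?_⟩, rfl⟩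
        rintro (rfl | rfl)
        · simp [hA'] at hC
        · exact hXB rfl
  rcases Set.eq_empty_or_nonempty (Subtype.val ⁻¹' B : Set s) with hB' | hB'
  · left
    ext C
    constructor
    · rintro ⟨hC, X, rfl | ⟨hX, -⟩, rfl⟩
      · exact ⟨hC, A, hA, by simp [hB']⟩
      · exact ⟨hC, X, hX, rfl⟩
    · rintro ⟨hC, X, hX, rfl⟩
      by_cases hXA : X = A
      · exact ⟨hC, _, .inl rfl, by simp [hB', hXA]⟩
      · refine ⟨hC, X, .inr ⟨hX, ?_⟩, rfl⟩
        rintro (rfl | rfl)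
        · exact hXA rfl
        · simp [hB'] at hC
  right
  refine ⟨Subtype.val ⁻¹' A, ⟨hA', A, hA, rfl⟩, Subtype.val ⁻¹' B, ⟨hB', B, hB, rfl⟩,
    fun h => hAB (eq_of_trace A hA B hB hA' h), ?_⟩
  ext C
  constructor
  · rintro ⟨hC, X, rfl | ⟨hX, hXAB⟩, rfl⟩
    · exact .inl rfl
    · refine .inr ⟨⟨hC, X, hX, rfl⟩, ?_⟩
      rintro (h | h)
      · exact hXAB (.inl (eq_of_trace X hX A hA hC h))
      · exact hXAB (.inr (eq_of_trace X hX B hB hC h))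
  · rintro (rfl | ⟨⟨hC, X, hX, rfl⟩, hXAB⟩)
    · exact ⟨hA'.inl, A ∪ B, .inl rfl, rfl⟩
    · refine ⟨hC, X, .inr ⟨hX, ?_⟩, rfl⟩
      rintro (rfl | rfl)
      · exact hXAB (.inl rfl)
      · exact hXAB (.inr rfl)

theorem HasDSeq.induce [Finite V] {G : SimpleGraph V} {d : ℕ} (h : G.HasDSeq d) {s : Set V}
    (hs : s.Nonempty) : (G.induce s).HasDSeq d := by
  rw [hasDSeq_iff_reflTransGen] at h ⊢
  rw [← traceParts_range_singleton, ← traceParts_singleton_univ hs]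
  suffices ∀ P, Relation.ReflTransGen (G.BoundedStep d) (Set.range fun v => ({v} : Set V)) P →
      P.PairwiseDisjoint id ∧ Relation.ReflTransGen ((G.induce s).BoundedStep d)
        (traceParts s (Set.range fun v => ({v} : Set V))) (traceParts s P) from (this _ h).2
  intro P hP
  induction hP with
  | refl =>
    refine ⟨?_, .refl⟩
    rintro _ ⟨v, rfl⟩ _ ⟨w, rfl⟩ hvw
    exact Set.disjoint_singleton.2 fun h => hvw (by rw [h])
  | @tail P Q _ hPQ ih =>
    refine ⟨hPQ.1.pairwiseDisjoint ih.1, ?_⟩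
    rcases hPQ.1.traceParts ih.1 s with heq | hstep
    · rw [heq]
      exact ih.2
    · refine ih.2.tail ⟨hstep, ?_⟩
      rintro _ ⟨-, X, hX, rfl⟩
      exact (G.redDeg_traceParts_le s Q X).trans (hPQ.2 X hX)

theorem reflTransGen_twwStep_univ [Finite V] (P : Set (Set V)) (hP : P.Nonempty)
    (hcover : ⋃₀ P = Set.univ) : Relation.ReflTransGen TwwStep P {Set.univ} := by
  induction hn : P.ncard using Nat.strong_induction_on generalizing P with
  | _ n ih =>
    subst hn
    rcases hP.exists_eq_singleton_or_nontrivial with ⟨X, rfl⟩ | ⟨A, hA, B, hB, hAB⟩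
    · rw [Set.sUnion_singleton] at hcover
      rw [hcover]
    · refine .head ⟨A, hA, B, hB, hAB, rfl⟩ (ih _ ?_ _ (Set.insert_nonempty _ _) ?_ rfl)
      · have hsub : {A, B} ⊆ P := Set.insert_subset hA (Set.singleton_subset_iff.2 hB)
        have hdiff := Set.ncard_sdiff_add_ncard_of_subset hsub
        rw [Set.ncard_pair hAB] at hdiff
        have hins := Set.ncard_insert_le (A ∪ B) (P \ {A, B})
        omega
      · refine Set.eq_univ_of_forall fun x => ?_
        obtain ⟨X, hX, hx⟩ := Set.mem_sUnion.1 (hcover ▸ Set.mem_univ x)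
        by_cases hXAB : X ∈ ({A, B} : Set (Set V))
        · refine ⟨A ∪ B, .inl rfl, ?_⟩
          rcases hXAB with rfl | rfl
          · exact .inl hx
          · exact .inr hx
        · exact ⟨X, .inr ⟨hX, hXAB⟩, hx⟩

theorem redDeg_le_card [Finite V] (G : SimpleGraph V) (P : Set (Set V)) (X : Set V) :
    G.redDeg P X ≤ Nat.card (Set V) :=
  Set.ncard_le_card _

theorem exists_hasDSeq [Finite V] [Nonempty V] (G : SimpleGraph V) : ∃ d, G.HasDSeq d := by
  refine ⟨Nat.card (Set V), hasDSeq_iff_reflTransGen.2 ?_⟩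
  refine Relation.ReflTransGen.mono (fun P Q h => ⟨h, fun X _ => G.redDeg_le_card Q X⟩) _ _
    (reflTransGen_twwStep_univ _ (Set.range_nonempty _) ?_)
  exact Set.eq_univ_of_forall fun x => ⟨{x}, ⟨x, rfl⟩, rfl⟩

theorem not_hasDSeq_of_isEmpty [IsEmpty V] (G : SimpleGraph V) (d : ℕ) : ¬ G.HasDSeq d := by
  rw [hasDSeq_iff_reflTransGen, Set.range_eq_empty]
  intro h
  rcases h.cases_head with h | ⟨_, ⟨⟨A, hA, -⟩, -⟩, -⟩
  · exact Set.singleton_ne_empty _ h.symm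
  · exact hA

end SimpleGraph

/-- If `G'` is an induced subgraph of a graph `G`, then
`tww(G') ≤ tww(G)`. -/
theorem twinWidth_induce_le {V : Type*} [Fintype V] (G : SimpleGraph V) (s : Set V) :
    (G.induce s).twinWidth ≤ G.twinWidth := by
  rcases s.eq_empty_or_nonempty with rfl | hs
  · have hempty : {d | (G.induce (∅ : Set V)).HasDSeq d} = ∅ :=
      Set.eq_empty_of_forall_notMem fun d => SimpleGraph.not_hasDSeq_of_isEmpty _ d
    rw [SimpleGraph.twinWidth, hempty, Nat.sInf_empty]
    exact Nat.zero_le _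
  · have := hs.to_type
    have hmem : G.HasDSeq G.twinWidth := Nat.sInf_mem G.exists_hasDSeq
    exact Nat.sInf_le (hmem.induce hs)
end

section
/- The cycle C_5 on 5 vertices has twin-width 2, every graph on at most 4 vertices has twin-width at most 1, and every graph on 5 vertices of twin-width 2 is isomorphic to C_5. In particular, the smallest number of vertices of a graph of twin-width 2 is 5, and C_5 is the unique such graph up to isomorphism. -/
universe u

section Contraction

variable {V : Type*} {G : SimpleGraph V} {d : ℕ}

theorem SimpleGraph.MixedPair.symm {P Q : Set V} (h : G.MixedPair P Q) : G.MixedPair Q P :=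
  ⟨fun h' => h.1 fun x hx y hy => (h' y hy x hx).symm,
    fun h' => h.2 fun x hx y hy hxy => h' y hy x hx hxy.symm⟩

theorem SimpleGraph.not_mixedPair_singleton_s9 (x y : V) : ¬ G.MixedPair {x} {y} := by
  simp [SimpleGraph.MixedPair]

theorem TwwStep.of_insert {A B : Set V} {R : Set (Set V)} (hAB : A ≠ B) (hA : A ∉ R) (hB : B ∉ R) :
    TwwStep (insert A (insert B R)) (insert (A ∪ B) R) := by
  refine ⟨A, by simp, B, by simp, hAB, ?_⟩
  congr 1
  ext X
  simp only [Set.mem_insert_iff, Set.mem_singleton_iff, Set.mem_sdiff, not_or]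
  constructor
  · intro hX
    exact ⟨Or.inr (Or.inr hX), fun h => hA (h ▸ hX), fun h => hB (h ▸ hX)⟩
  · tauto

/-- The trigraph given by the partition `P` can be contracted to a single vertex
with red degrees at most `d` throughout. -/
def SimpleGraph.Contractible (G : SimpleGraph V) (d : ℕ) (P : Set (Set V)) : Prop :=
  ∃ (N : ℕ) (f : ℕ → Set (Set V)), f 0 = P ∧ (∀ i < N, TwwStep (f i) (f (i + 1))) ∧
    f N = {Set.univ} ∧ ∀ i ≤ N, ∀ A ∈ f i, G.redDeg (f i) A ≤ d

theorem SimpleGraph.Contractible.of_step {P Q : Set (Set V)} (hQ : G.Contractible d Q)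
    (hP : ∀ A ∈ P, G.redDeg P A ≤ d) (h : TwwStep P Q) : G.Contractible d P := by
  obtain ⟨N, f, h0, hs, hN, hd⟩ := hQ
  refine ⟨N + 1, fun i => i.casesOn P f, rfl, ?_, hN, ?_⟩
  · rintro (_ | i) hi
    · simpa [h0] using h
    · exact hs i (by omega)
  · rintro (_ | i) hi
    · exact hP
    · exact hd i (by omega)

theorem SimpleGraph.contractible_univ : G.Contractible d {Set.univ} := by
  refine ⟨0, fun _ => {Set.univ}, rfl, by simp, rfl, ?_⟩
  rintro i - A rfl
  have : {Q ∈ ({Set.univ} : Set (Set V)) | Q ≠ Set.univ ∧ G.MixedPair Set.univ Q} = ∅ := by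
    ext Q
    simp only [Set.mem_ofPred_eq, Set.mem_singleton_iff, Set.mem_empty_iff_false]
    tauto
  rw [SimpleGraph.redDeg, this, Set.ncard_empty]
  exact d.zero_le

theorem SimpleGraph.redDeg_lt_ncard {P : Set (Set V)} (hP : P.Finite) {A : Set V} (hA : A ∈ P) :
    G.redDeg P A < P.ncard :=
  Set.ncard_lt_ncard ⟨fun _ h => h.1, fun h => (h hA).2.1 rfl⟩ hP

/-- A cover by at most `d + 1` parts can be contracted in any order. -/
theorem SimpleGraph.contractible_of_ncard_le {P : Set (Set V)} (hP : P.Finite) (hne : P.Nonempty)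
    (hcov : ⋃₀ P = Set.univ) (hcard : P.ncard ≤ d + 1) : G.Contractible d P := by
  induction hn : P.ncard using Nat.strong_induction_on generalizing P with
  | _ n ih =>
  by_cases hsub : P.Subsingleton
  · obtain ⟨A, hA⟩ := hne
    have hPA : P = {A} := hsub.eq_singleton_of_mem hA
    have hAu : A = Set.univ := by simpa [hPA] using hcov
    rw [hPA, hAu]
    exact contractible_univ
  · obtain ⟨A, hA, B, hB, hAB⟩ := Set.not_subsingleton_iff.1 hsub
    have hlt : (insert (A ∪ B) (P \ {A, B})).ncard < P.ncard := by
      have h1 := Set.ncard_insert_le (A ∪ B) (P \ {A, B})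
      have h2 := Set.ncard_sdiff_add_ncard_of_subset (s := {A, B}) (t := P)
        (by rintro x (rfl | rfl) <;> assumption) hP
      rw [Set.ncard_pair hAB] at h2
      omega
    refine (ih _ (hn ▸ hlt) (hP.sdiff.insert _) (Set.insert_nonempty _ _) ?_ (by omega) rfl).of_step
      (fun C hC => ?_) ⟨A, hA, B, hB, hAB, rfl⟩
    · rw [Set.eq_univ_iff_forall] at hcov ⊢
      intro x
      obtain ⟨C, hC, hx⟩ := hcov x
      by_cases h : C = A ∨ C = B
      · refine ⟨_, Set.mem_insert _ _, ?_⟩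
        rcases h with rfl | rfl
        · exact Or.inl hx
        · exact Or.inr hx
      · exact ⟨C, Or.inr ⟨hC, h⟩, hx⟩
    · have := redDeg_lt_ncard (G := G) hP hC
      omega

theorem SimpleGraph.redDeg_le_one {P : Set (Set V)} (hP : P.Finite) {A : Set V}
    (h : ∀ B ∈ P, ∀ C ∈ P, B ≠ A → C ≠ A → G.MixedPair A B → G.MixedPair A C → B = C) :
    G.redDeg P A ≤ 1 :=
  (Set.ncard_le_one (hP.subset fun _ h => h.1)).2
    fun B hB C hC => h B hB.1 C hC.1 hB.2.1 hC.2.1 hB.2.2 hC.2.2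

theorem SimpleGraph.redDeg_singletons (A : Set V) (hA : A ∈ Set.range fun v : V => ({v} : Set V)) :
    G.redDeg (Set.range fun v => {v}) A = 0 := by
  obtain ⟨x, rfl⟩ := hA
  have : {Q ∈ Set.range fun v : V => ({v} : Set V) | Q ≠ {x} ∧ G.MixedPair {x} Q} = ∅ := by
    ext Q
    simp only [Set.mem_ofPred_eq, Set.mem_empty_iff_false, iff_false]
    rintro ⟨⟨y, rfl⟩, -, h⟩
    exact not_mixedPair_singleton_s9 _ _ h
  rw [SimpleGraph.redDeg, this, Set.ncard_empty]

/-- The first contraction of a contraction sequence is unconstrained by the singletons. -/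
theorem SimpleGraph.hasDSeq_of_step {Q : Set (Set V)} (hQ : G.Contractible d Q)
    (h : TwwStep (Set.range fun v => {v}) Q) : G.HasDSeq d :=
  hQ.of_step (fun A hA => (redDeg_singletons A hA).trans_le d.zero_le) h

theorem SimpleGraph.contractible_three {A B C : Set V} (hAB : A ≠ B) (hAC : A ≠ C) (hBC : B ≠ C)
    (hcov : A ∪ B ∪ C = Set.univ)
    (h₁ : ¬ (G.MixedPair A B ∧ G.MixedPair A C)) (h₂ : ¬ (G.MixedPair A B ∧ G.MixedPair B C))
    (h₃ : ¬ (G.MixedPair A C ∧ G.MixedPair B C)) : G.Contractible 1 {A, B, C} := by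
  have hstep : TwwStep {A, B, C} {A ∪ B, C} := by
    exact TwwStep.of_insert hAB (by simpa using hAC) (by simpa using hBC)
  refine (contractible_of_ncard_le (Set.toFinite _) (Set.insert_nonempty _ _) ?_
    (Set.ncard_insert_le _ _ |>.trans (by simp))).of_step
    (fun X hX => redDeg_le_one (Set.toFinite _) ?_) hstep
  · simpa [Set.sUnion_insert] using hcov
  · have hs : ∀ X Y, G.MixedPair X Y → G.MixedPair Y X := fun _ _ h => h.symm
    simp only [Set.mem_insert_iff, Set.mem_singleton_iff] at hX ⊢
    grind

end Contraction

section SmallGraphs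

/-- `x` distinguishes `a` and `b`. -/
abbrev Distinguishes {α : Type*} (R : α → α → Prop) (a b x : α) : Prop := ¬ (R a x ↔ R b x)

/-- At most one of `c`, `d`, `e` distinguishes `a` and `b`, and contracting either `c` into `{a, b}`,
or `c` and `d`, leaves no vertex of red degree two. -/
abbrev ReducibleOrder {α : Type*} (R : α → α → Prop) (a b c d e : α) : Prop :=
  (¬ (Distinguishes R a b c ∧ Distinguishes R a b d) ∧
    ¬ (Distinguishes R a b c ∧ Distinguishes R a b e) ∧
    ¬ (Distinguishes R a b d ∧ Distinguishes R a b e)) ∧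
  (¬ ((Distinguishes R a b d ∨ Distinguishes R a c d) ∧
      (Distinguishes R a b e ∨ Distinguishes R a c e)) ∨
    (¬ (Distinguishes R a b e ∧ Distinguishes R c d e) ∧
      ((¬ Distinguishes R a b e ∧ ¬ Distinguishes R c d e) ∨
        ((R a c ↔ R a d) ∧ (R a c ↔ R b c) ∧ (R a c ↔ R b d)))))

/-- `a b c d e` is an induced cycle. -/
abbrev InducedFiveCycle {α : Type*} (R : α → α → Prop) (a b c d e : α) : Prop :=
  (R a b ∧ R b c ∧ R c d ∧ R d e ∧ R a e) ∧ ¬ R a c ∧ ¬ R a d ∧ ¬ R b d ∧ ¬ R b e ∧ ¬ R c e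

variable {V : Type*} {G : SimpleGraph V}

theorem mixedPair_pair_singleton_iff {a b x : V} :
    G.MixedPair {a, b} {x} ↔ Distinguishes G.Adj a b x := by
  simp only [SimpleGraph.MixedPair, Set.mem_insert_iff, Set.mem_singleton_iff,
    forall_eq_or_imp, forall_eq]
  tauto

theorem mixedPair_triple_singleton_iff {a b c x : V} :
    G.MixedPair {a, b, c} {x} ↔ Distinguishes G.Adj a b x ∨ Distinguishes G.Adj a c x := by
  simp only [SimpleGraph.MixedPair, Set.mem_insert_iff, Set.mem_singleton_iff,
    forall_eq_or_imp, forall_eq]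
  tauto

theorem mixedPair_pair_pair_iff {a b c d : V} : G.MixedPair {a, b} {c, d} ↔
    ¬ ((G.Adj a c ↔ G.Adj a d) ∧ (G.Adj a c ↔ G.Adj b c) ∧ (G.Adj a c ↔ G.Adj b d)) := by
  simp only [SimpleGraph.MixedPair, Set.mem_insert_iff, Set.mem_singleton_iff,
    forall_eq_or_imp, forall_eq]
  tauto

theorem hasDSeq_one_of_reducibleOrder {a b c d e : V} (hnd : [a, b, c, d, e].Nodup)
    (hcov : ∀ x, x = a ∨ x = b ∨ x = c ∨ x = d ∨ x = e)
    (h : ReducibleOrder G.Adj a b c d e) : G.HasDSeq 1 := by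
  simp only [List.nodup_cons, List.mem_cons, List.not_mem_nil, or_false, not_or] at hnd
  obtain ⟨⟨hab, hac, had, hae⟩, ⟨hbc, hbd, hbe⟩, ⟨hcd, hce⟩, hde, -⟩ := hnd
  have hs : ∀ x y, G.MixedPair {x} {y} → False := SimpleGraph.not_mixedPair_singleton_s9
  have hp : ∀ x, G.MixedPair {a, b} {x} → Distinguishes G.Adj a b x :=
    fun x => mixedPair_pair_singleton_iff.1
  have hab_pair : ∀ x, ({x} : Set V) ≠ {a, b} := by
    intro x hx
    have h1 : a ∈ ({x} : Set V) := hx ▸ Set.mem_insert _ _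
    have h2 : b ∈ ({x} : Set V) := hx ▸ Set.mem_insert_of_mem _ rfl
    exact hab (h1.trans h2.symm)
  have hfirst : TwwStep (Set.range fun v : V => ({v} : Set V)) {{a, b}, {c}, {d}, {e}} := by
    have hr : (Set.range fun v : V => ({v} : Set V)) = {{a}, {b}, {c}, {d}, {e}} := by
      ext X
      simp only [Set.mem_range, Set.mem_insert_iff, Set.mem_singleton_iff]
      constructor
      · rintro ⟨x, rfl⟩
        simpa only [Set.singleton_eq_singleton_iff] using hcov x
      · rintro (rfl | rfl | rfl | rfl | rfl) <;> exact ⟨_, rfl⟩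
    rw [hr, ← Set.singleton_union (a := a) (s := {b})]
    exact TwwStep.of_insert (by simpa using hab) (by simp [*]) (by simp [*])
  refine SimpleGraph.hasDSeq_of_step ?_ hfirst
  have hred : ∀ X ∈ ({{a, b}, {c}, {d}, {e}} : Set (Set V)),
      G.redDeg {{a, b}, {c}, {d}, {e}} X ≤ 1 := by
    intro X hX
    refine SimpleGraph.redDeg_le_one (Set.toFinite _) ?_
    have := h.1
    simp only [Set.mem_insert_iff, Set.mem_singleton_iff] at hX ⊢
    rcases hX with rfl | rfl | rfl | rfl
    all_goals
      rintro B (rfl | rfl | rfl | rfl) C (rfl | rfl | rfl | rfl) hB hC hBm hCm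
      all_goals first
        | with_reducible rfl
        | exact (hs _ _ hBm).elim
        | exact (hs _ _ hCm).elim
        | exact (hB rfl).elim
        | exact (hC rfl).elim
        | exact (this.1 ⟨hp _ hBm, hp _ hCm⟩).elim
        | exact (this.1 ⟨hp _ hCm, hp _ hBm⟩).elim
        | exact (this.2.1 ⟨hp _ hBm, hp _ hCm⟩).elim
        | exact (this.2.1 ⟨hp _ hCm, hp _ hBm⟩).elim
        | exact (this.2.2 ⟨hp _ hBm, hp _ hCm⟩).elim
        | exact (this.2.2 ⟨hp _ hCm, hp _ hBm⟩).elim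
  obtain h' | h' := h.2
  · refine SimpleGraph.Contractible.of_step (Q := {{a, b, c}, {d}, {e}}) ?_ hred ?_
    · have ha3 : ∀ x, x ≠ a → ({a, b, c} : Set V) ≠ {x} := by
        intro x hx h3
        have : a ∈ ({x} : Set V) := h3 ▸ Set.mem_insert _ _
        exact hx this.symm
      have hp3 : ∀ x, G.MixedPair {a, b, c} {x} →
          Distinguishes G.Adj a b x ∨ Distinguishes G.Adj a c x :=
        fun x => mixedPair_triple_singleton_iff.1
      refine SimpleGraph.contractible_three (ha3 _ (Ne.symm had)) (ha3 _ (Ne.symm hae))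
        (by simpa using hde) ?_ ?_ ?_ ?_
      · ext x
        rcases hcov x with rfl | rfl | rfl | rfl | rfl <;> simp
      · exact fun hm => h' ⟨hp3 _ hm.1, hp3 _ hm.2⟩
      · exact fun hm => hs _ _ hm.2
      · exact fun hm => hs _ _ hm.2
    · have : ({a, b} : Set V) ∪ {c} = {a, b, c} := by
        rw [Set.insert_union, Set.singleton_union]
      rw [← this]
      exact TwwStep.of_insert (hab_pair c).symm (by simp [(hab_pair _).symm]) (by simp [*])
  · refine SimpleGraph.Contractible.of_step (Q := {{a, b}, {c, d}, {e}}) ?_ hred ?_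
    · have hpc : G.MixedPair {c, d} {e} → Distinguishes G.Adj c d e :=
        mixedPair_pair_singleton_iff.1
      have hpp : G.MixedPair {a, b} {c, d} →
          ¬ ((G.Adj a c ↔ G.Adj a d) ∧ (G.Adj a c ↔ G.Adj b c) ∧ (G.Adj a c ↔ G.Adj b d)) :=
        mixedPair_pair_pair_iff.1
      have hpe := hp e
      refine SimpleGraph.contractible_three ?_ (hab_pair e).symm ?_ ?_ ?_ ?_ ?_
      · intro hx
        have : a ∈ ({c, d} : Set V) := hx ▸ Set.mem_insert _ _
        exact this.elim hac had
      · intro hx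
        have : c ∈ ({e} : Set V) := hx ▸ Set.mem_insert _ _
        exact hce this
      · ext x
        rcases hcov x with rfl | rfl | rfl | rfl | rfl <;> simp
      · exact fun hm => h'.2.elim (fun h => h.1 (hpe hm.2)) (hpp hm.1)
      · exact fun hm => h'.2.elim (fun h => h.2 (hpc hm.2)) (hpp hm.1)
      · exact fun hm => h'.1 ⟨hpe hm.1, hpc hm.2⟩
    · have : ({c} : Set V) ∪ {d} = {c, d} := Set.singleton_union
      rw [← this, Set.insert_comm ({a, b} : Set V) {c}, Set.insert_comm ({a, b} : Set V) {d},
        Set.insert_comm ({a, b} : Set V) ({c} ∪ {d})]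
      exact TwwStep.of_insert (by simpa using hcd) (by simp [*]) (by simp [*])

theorem hasDSeq_one_of_distinguishes {a b c d : V} (hab : a ≠ b) (hac : a ≠ c) (had : a ≠ d)
    (hbc : b ≠ c) (hbd : b ≠ d) (hcd : c ≠ d) (hcov : ∀ x, x = a ∨ x = b ∨ x = c ∨ x = d)
    (h : ¬ (Distinguishes G.Adj a b c ∧ Distinguishes G.Adj a b d)) : G.HasDSeq 1 := by
  have hp : ∀ x, G.MixedPair {a, b} {x} → Distinguishes G.Adj a b x :=
    fun x => mixedPair_pair_singleton_iff.1
  have ha2 : ∀ x, x ≠ a → ({a, b} : Set V) ≠ {x} := by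
    intro x hx h3
    have : a ∈ ({x} : Set V) := h3 ▸ Set.mem_insert _ _
    exact hx this.symm
  have hfirst : TwwStep (Set.range fun v : V => ({v} : Set V)) {{a, b}, {c}, {d}} := by
    have hr : (Set.range fun v : V => ({v} : Set V)) = {{a}, {b}, {c}, {d}} := by
      ext X
      simp only [Set.mem_range, Set.mem_insert_iff, Set.mem_singleton_iff]
      constructor
      · rintro ⟨x, rfl⟩
        simpa only [Set.singleton_eq_singleton_iff] using hcov x
      · rintro (rfl | rfl | rfl | rfl) <;> exact ⟨_, rfl⟩
    rw [hr, ← Set.singleton_union (a := a) (s := {b})]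
    exact TwwStep.of_insert (by simpa using hab) (by simp [*]) (by simp [*])
  refine SimpleGraph.hasDSeq_of_step (SimpleGraph.contractible_three (ha2 _ hac.symm)
    (ha2 _ had.symm) (by simpa using hcd) ?_ ?_ ?_ ?_) hfirst
  · ext x
    have := hcov x
    simp only [Set.mem_union, Set.mem_insert_iff, Set.mem_singleton_iff, Set.mem_univ]
    tauto
  · exact fun hm => h ⟨hp _ hm.1, hp _ hm.2⟩
  · exact fun hm => SimpleGraph.not_mixedPair_singleton_s9 _ _ hm.2
  · exact fun hm => SimpleGraph.not_mixedPair_singleton_s9 _ _ hm.2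

/-- The symmetric irreflexive relation on five points with given values on pairs. -/
def relOfPairs (p₀₁ p₀₂ p₀₃ p₀₄ p₁₂ p₁₃ p₁₄ p₂₃ p₂₄ p₃₄ : Bool) : Fin 5 → Fin 5 → Bool
  | 0, 1 | 1, 0 => p₀₁
  | 0, 2 | 2, 0 => p₀₂
  | 0, 3 | 3, 0 => p₀₃
  | 0, 4 | 4, 0 => p₀₄
  | 1, 2 | 2, 1 => p₁₂
  | 1, 3 | 3, 1 => p₁₃
  | 1, 4 | 4, 1 => p₁₄
  | 2, 3 | 3, 2 => p₂₃
  | 2, 4 | 4, 2 => p₂₄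
  | 3, 4 | 4, 3 => p₃₄
  | _, _ => false

/-- The orderings of five points, up to exchanging the first two. -/
def fiveOrders : List (Fin 5 × Fin 5 × Fin 5 × Fin 5 × Fin 5) :=
  [(0, 1, 2, 3, 4), (0, 1, 2, 4, 3), (0, 1, 3, 2, 4), (0, 1, 3, 4, 2), (0, 1, 4, 2, 3),
    (0, 1, 4, 3, 2), (0, 2, 1, 3, 4), (0, 2, 1, 4, 3), (0, 2, 3, 1, 4), (0, 2, 3, 4, 1),
    (0, 2, 4, 1, 3), (0, 2, 4, 3, 1), (0, 3, 1, 2, 4), (0, 3, 1, 4, 2), (0, 3, 2, 1, 4),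
    (0, 3, 2, 4, 1), (0, 3, 4, 1, 2), (0, 3, 4, 2, 1), (0, 4, 1, 2, 3), (0, 4, 1, 3, 2),
    (0, 4, 2, 1, 3), (0, 4, 2, 3, 1), (0, 4, 3, 1, 2), (0, 4, 3, 2, 1), (1, 2, 0, 3, 4),
    (1, 2, 0, 4, 3), (1, 2, 3, 0, 4), (1, 2, 3, 4, 0), (1, 2, 4, 0, 3), (1, 2, 4, 3, 0),
    (1, 3, 0, 2, 4), (1, 3, 0, 4, 2), (1, 3, 2, 0, 4), (1, 3, 2, 4, 0), (1, 3, 4, 0, 2),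
    (1, 3, 4, 2, 0), (1, 4, 0, 2, 3), (1, 4, 0, 3, 2), (1, 4, 2, 0, 3), (1, 4, 2, 3, 0),
    (1, 4, 3, 0, 2), (1, 4, 3, 2, 0), (2, 3, 0, 1, 4), (2, 3, 0, 4, 1), (2, 3, 1, 0, 4),
    (2, 3, 1, 4, 0), (2, 3, 4, 0, 1), (2, 3, 4, 1, 0), (2, 4, 0, 1, 3), (2, 4, 0, 3, 1),
    (2, 4, 1, 0, 3), (2, 4, 1, 3, 0), (2, 4, 3, 0, 1), (2, 4, 3, 1, 0), (3, 4, 0, 1, 2),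
    (3, 4, 0, 2, 1), (3, 4, 1, 0, 2), (3, 4, 1, 2, 0), (3, 4, 2, 0, 1), (3, 4, 2, 1, 0)]

/-- The cyclic orderings of five points, up to reversal. -/
def fiveCycles : List (Fin 5 × Fin 5 × Fin 5 × Fin 5 × Fin 5) :=
  [(0, 1, 2, 3, 4), (0, 1, 2, 4, 3), (0, 1, 3, 2, 4), (0, 1, 3, 4, 2), (0, 1, 4, 2, 3),
    (0, 1, 4, 3, 2), (0, 2, 1, 3, 4), (0, 2, 1, 4, 3), (0, 2, 3, 1, 4), (0, 2, 4, 1, 3),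
    (0, 3, 1, 2, 4), (0, 3, 2, 1, 4)]

/-- Boolean form of `ReducibleOrder`. -/
def reducibleOrderBool (R : Fin 5 → Fin 5 → Bool) : Fin 5 × Fin 5 × Fin 5 × Fin 5 × Fin 5 → Bool
  | (a, b, c, d, e) =>
    let D := fun a b x => xor (R a x) (R b x)
    !(D a b c && D a b d) && !(D a b c && D a b e) && !(D a b d && D a b e) &&
      (!((D a b d || D a c d) && (D a b e || D a c e)) ||
        (!(D a b e && D c d e) && ((!D a b e && !D c d e) ||
          (!xor (R a c) (R a d) && !xor (R a c) (R b c) && !xor (R a c) (R b d)))))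

/-- Boolean form of `InducedFiveCycle`. -/
def inducedFiveCycleBool (R : Fin 5 → Fin 5 → Bool) : Fin 5 × Fin 5 × Fin 5 × Fin 5 × Fin 5 → Bool
  | (a, b, c, d, e) =>
    R a b && R b c && R c d && R d e && R a e && !R a c && !R a d && !R b d && !R b e && !R c e

set_option synthInstance.maxHeartbeats 400000 in
set_option synthInstance.maxSize 4096 in
theorem reducibleOrder_of_bool {R : Fin 5 → Fin 5 → Bool} {a b c d e : Fin 5}
    (h : reducibleOrderBool R (a, b, c, d, e) = true) :
    ReducibleOrder (fun i j => R i j = true) a b c d e := by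
  revert h
  simp only [reducibleOrderBool, ReducibleOrder, Distinguishes]
  generalize R a c = p₁, R a d = p₂, R a e = p₃, R b c = p₄, R b d = p₅, R b e = p₆, R c d = p₇,
    R c e = p₈, R d e = p₉
  revert p₁ p₂ p₃ p₄ p₅ p₆ p₇ p₈ p₉
  decide +kernel

theorem inducedFiveCycle_of_bool {R : Fin 5 → Fin 5 → Bool} {a b c d e : Fin 5}
    (h : inducedFiveCycleBool R (a, b, c, d, e) = true) :
    InducedFiveCycle (fun i j => R i j = true) a b c d e := by
  simp_all [inducedFiveCycleBool, InducedFiveCycle]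

theorem nodup_of_mem_fiveOrders : ∀ t ∈ fiveOrders ++ fiveCycles,
    [t.1, t.2.1, t.2.2.1, t.2.2.2.1, t.2.2.2.2].Nodup := by
  decide +kernel

theorem any_reducibleOrderBool_or_any_inducedFiveCycleBool :
    ∀ p₀₁ p₀₂ p₀₃ p₀₄ p₁₂ p₁₃ p₁₄ p₂₃ p₂₄ p₃₄ : Bool,
      (fun R => fiveOrders.any (reducibleOrderBool R) || fiveCycles.any (inducedFiveCycleBool R))
        (relOfPairs p₀₁ p₀₂ p₀₃ p₀₄ p₁₂ p₁₃ p₁₄ p₂₃ p₂₄ p₃₄) := by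
  decide +kernel

/-- `R` has a reducible ordering of its points, or is a five-cycle. -/
def ReducibleOrFiveCycle (R : Fin 5 → Fin 5 → Prop) : Prop :=
  (∃ a b c d e, [a, b, c, d, e].Nodup ∧ ReducibleOrder R a b c d e) ∨
  ∃ a b c d e, [a, b, c, d, e].Nodup ∧ InducedFiveCycle R a b c d e

theorem reducibleOrFiveCycle_relOfPairs (p₀₁ p₀₂ p₀₃ p₀₄ p₁₂ p₁₃ p₁₄ p₂₃ p₂₄ p₃₄ : Bool) :
    ReducibleOrFiveCycle
      fun i j => relOfPairs p₀₁ p₀₂ p₀₃ p₀₄ p₁₂ p₁₃ p₁₄ p₂₃ p₂₄ p₃₄ i j = true := by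
  have h := any_reducibleOrderBool_or_any_inducedFiveCycleBool
    p₀₁ p₀₂ p₀₃ p₀₄ p₁₂ p₁₃ p₁₄ p₂₃ p₂₄ p₃₄
  simp only [Bool.or_eq_true, List.any_eq_true] at h
  obtain ⟨⟨a, b, c, d, e⟩, hmem, h⟩ | ⟨⟨a, b, c, d, e⟩, hmem, h⟩ := h
  · exact Or.inl ⟨a, b, c, d, e, nodup_of_mem_fiveOrders _ (List.mem_append_left _ hmem),
      reducibleOrder_of_bool h⟩
  · exact Or.inr ⟨a, b, c, d, e, nodup_of_mem_fiveOrders _ (List.mem_append_right _ hmem),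
      inducedFiveCycle_of_bool h⟩

open scoped Classical in
theorem reducibleOrFiveCycle_of_symm {R : Fin 5 → Fin 5 → Prop} (hsymm : ∀ i j, R i j → R j i)
    (hirr : ∀ i, ¬ R i i) : ReducibleOrFiveCycle R := by
  convert reducibleOrFiveCycle_relOfPairs (R 0 1) (R 0 2) (R 0 3) (R 0 4) (R 1 2) (R 1 3) (R 1 4)
    (R 2 3) (R 2 4) (R 3 4) using 3 with i j
  fin_cases i <;> fin_cases j <;> simp [relOfPairs, hirr] <;>
    exact ⟨hsymm _ _, hsymm _ _⟩

theorem exists_pair_of_symm (R : Fin 4 → Fin 4 → Prop) (hsymm : ∀ i j, R i j → R j i) :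
    ∃ a b c d : Fin 4, [a, b, c, d].Nodup ∧
      ¬ (Distinguishes R a b c ∧ Distinguishes R a b d) := by
  have h1 := hsymm
  by_contra! h
  have h01 := h 0 1 2 3 (by decide)
  have h02 := h 0 2 1 3 (by decide)
  have h03 := h 0 3 1 2 (by decide)
  have h12 := h 1 2 0 3 (by decide)
  grind

theorem nodup_and_cover_of_bijective {f : Fin 5 → V} (hf : f.Bijective) {a b c d e : Fin 5}
    (h : [a, b, c, d, e].Nodup) :
    [f a, f b, f c, f d, f e].Nodup ∧
      ∀ x, x = f a ∨ x = f b ∨ x = f c ∨ x = f d ∨ x = f e := by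
  refine ⟨by simpa using h.map hf.1, fun x => ?_⟩
  obtain ⟨i, rfl⟩ := hf.2 x
  have : i = a ∨ i = b ∨ i = c ∨ i = d ∨ i = e := by
    simp only [List.nodup_cons, List.mem_cons, List.not_mem_nil, or_false, not_or] at h
    omega
  rcases this with rfl | rfl | rfl | rfl | rfl <;> simp

theorem nonempty_iso_cycleGraph_five {a b c d e : V} (hnd : [a, b, c, d, e].Nodup)
    (hcov : ∀ x, x = a ∨ x = b ∨ x = c ∨ x = d ∨ x = e)
    (h : InducedFiveCycle G.Adj a b c d e) : Nonempty (G ≃g SimpleGraph.cycleGraph 5) := by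
  have hbij : Function.Bijective ![a, b, c, d, e] := by
    constructor
    · rw [← List.nodup_ofFn]
      simpa [List.ofFn_succ] using hnd
    · intro x
      rcases hcov x with rfl | rfl | rfl | rfl | rfl
      exacts [⟨0, rfl⟩, ⟨1, rfl⟩, ⟨2, rfl⟩, ⟨3, rfl⟩, ⟨4, rfl⟩]
  refine ⟨RelIso.symm ⟨Equiv.ofBijective _ hbij, ?_⟩⟩
  intro i j
  obtain ⟨⟨h1, h2, h3, h4, h5⟩, h6, h7, h8, h9, h10⟩ := h
  have hc := G.adj_comm
  fin_cases i <;> fin_cases j <;>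
    simp [SimpleGraph.cycleGraph_adj, *, hc b a, hc c b, hc d c, hc e d, hc e a, hc c a, hc d a,
      hc d b, hc e b, hc e c] <;> decide

theorem twinWidth_le_one_of_hasDSeq (h : G.HasDSeq 1) : G.twinWidth ≤ 1 := Nat.sInf_le h

theorem twinWidth_le_one_of_card_le_four [Fintype V] (hV : Fintype.card V ≤ 4) :
    G.twinWidth ≤ 1 := by
  have hsing : Function.Injective fun v : V => ({v} : Set V) := Set.singleton_injective
  have hcard : (Set.range fun v : V => ({v} : Set V)).ncard = Fintype.card V := by
    rw [← Set.image_univ, Set.ncard_image_of_injective _ hsing, Set.ncard_univ,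
      Nat.card_eq_fintype_card]
  rcases isEmpty_or_nonempty V with hE | hN
  · have : {d | G.HasDSeq d} = ∅ := by
      ext d
      simp only [Set.mem_ofPred_eq, Set.mem_empty_iff_false, iff_false]
      rintro ⟨N, f, h0, hs, hN, -⟩
      have h0' : f 0 = ∅ := by
        rw [h0]
        exact Set.range_eq_empty _
      rcases N.eq_zero_or_pos with rfl | hpos
      · rw [h0'] at hN
        exact Set.singleton_ne_empty _ hN.symm
      · obtain ⟨A, hA, -⟩ := hs 0 hpos
        rw [h0'] at hA
        exact hA
    simp [SimpleGraph.twinWidth, this]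
  refine twinWidth_le_one_of_hasDSeq ?_
  obtain hle | h3 | h4 : Fintype.card V ≤ 2 ∨ Fintype.card V = 3 ∨ Fintype.card V = 4 := by omega
  · exact SimpleGraph.contractible_of_ncard_le (Set.toFinite _) (Set.range_nonempty _)
      (by ext; simp) (by omega)
  · let f := (Fintype.equivFinOfCardEq h3).symm
    have hcov : ({f 0} ∪ {f 1} ∪ {f 2} : Set V) = Set.univ := by
      ext x
      obtain ⟨i, rfl⟩ := f.surjective x
      fin_cases i <;> simp
    have hr : (Set.range fun v : V => ({v} : Set V)) = {{f 0}, {f 1}, {f 2}} := by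
      ext X
      constructor
      · rintro ⟨x, rfl⟩
        obtain ⟨i, rfl⟩ := f.surjective x
        fin_cases i <;> simp
      · rintro (rfl | rfl | rfl) <;> exact ⟨_, rfl⟩
    have hs := SimpleGraph.not_mixedPair_singleton_s9 (G := G)
    change G.Contractible 1 _
    rw [hr]
    exact SimpleGraph.contractible_three (by simp) (by simp) (by simp) hcov
      (fun h => hs _ _ h.1) (fun h => hs _ _ h.1) (fun h => hs _ _ h.1)
  · let f := (Fintype.equivFinOfCardEq h4).symm
    obtain ⟨a, b, c, d, hnd, h⟩ := exists_pair_of_symm (fun i j => G.Adj (f i) (f j))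
      fun _ _ h => h.symm
    simp only [List.nodup_cons, List.mem_cons, List.not_mem_nil, or_false, not_or] at hnd
    refine hasDSeq_one_of_distinguishes (a := f a) (b := f b) (c := f c) (d := f d)
      (by simp; tauto) (by simp; tauto) (by simp; tauto) (by simp; tauto) (by simp; tauto)
      (by simp; tauto) (fun x => ?_) h
    obtain ⟨i, rfl⟩ := f.surjective x
    simp only [EmbeddingLike.apply_eq_iff_eq]
    omega

end SmallGraphs

section FiveCycle

theorem twwStep_range_singletons {V : Type*} {Q : Set (Set V)}
    (h : TwwStep (Set.range fun v => {v}) Q) :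
    ∃ a b : V, a ≠ b ∧ Q = insert {a, b} (Set.range (fun v => {v}) \ {{a}, {b}}) := by
  obtain ⟨_, ⟨a, rfl⟩, _, ⟨b, rfl⟩, hab, rfl⟩ := h
  exact ⟨a, b, by simpa using hab, by rw [Set.singleton_union]⟩

/-- If two points outside of every pair distinguish it, the first contraction already has
red degree at least two. -/
theorem not_hasDSeq_one {V : Type*} [Finite V] [Nontrivial V] {G : SimpleGraph V}
    (h : ∀ a b, a ≠ b → ∃ c d, c ≠ d ∧ c ≠ a ∧ c ≠ b ∧ d ≠ a ∧ d ≠ b ∧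
      Distinguishes G.Adj a b c ∧ Distinguishes G.Adj a b d) {k : ℕ} (hk : k ≤ 1) :
    ¬ G.HasDSeq k := by
  rintro ⟨N, f, h0, hs, hN, hd⟩
  obtain ⟨x, y, hxy⟩ := exists_pair_ne V
  have hpos : 0 < N := by
    rcases Nat.eq_zero_or_pos N with rfl | h
    · have hx : ({x} : Set V) ∈ f 0 := h0 ▸ ⟨x, rfl⟩
      rw [hN] at hx
      have : y ∈ ({x} : Set V) := by
        rw [Set.mem_singleton_iff.1 hx]
        trivial
      exact (hxy this.symm).elim
    · exact h
  have h1 := hs 0 hpos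
  rw [h0] at h1
  obtain ⟨a, b, hab, hQ⟩ := twwStep_range_singletons h1
  obtain ⟨c, d, hcd, hca, hcb, hda, hdb, hc, hdd⟩ := h a b hab
  have hle := (hd 1 hpos {a, b} (by simp [hQ])).trans hk
  have hm : ∀ z, Distinguishes G.Adj a b z → G.MixedPair {a, b} {z} :=
    fun z => mixedPair_pair_singleton_iff.2
  have hne : ∀ z, z ≠ a → ({z} : Set V) ≠ {a, b} := by
    intro z hz h'
    have : a ∈ ({z} : Set V) := h' ▸ Set.mem_insert _ _
    exact hz this.symm
  have hfin : {Q ∈ f 1 | Q ≠ {a, b} ∧ G.MixedPair {a, b} Q}.Finite := Set.toFinite _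
  have := (Set.ncard_le_one hfin).1 hle {c} ⟨by simp [hQ, hca, hcb], hne c hca, hm c hc⟩
    {d} ⟨by simp [hQ, hda, hdb], hne d hda, hm d hdd⟩
  exact hcd (Set.singleton_injective this)

theorem cycleGraph_five_adj {i j : Fin 5} :
    (SimpleGraph.cycleGraph 5).Adj i j ↔ i - j = 1 ∨ j - i = 1 :=
  SimpleGraph.cycleGraph_adj

theorem hasDSeq_two_cycleGraph_five : (SimpleGraph.cycleGraph 5).HasDSeq 2 := by
  have hr : (Set.range fun v : Fin 5 => ({v} : Set (Fin 5))) = {{0}, {1}, {2}, {3}, {4}} := by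
    ext X
    simp [Fin.exists_fin_succ, eq_comm (a := X)]
  have h01 : ∀ x : Fin 5, ({0, 1} : Set (Fin 5)) ≠ {x} := by
    intro x h
    have h0 : (0 : Fin 5) ∈ ({x} : Set (Fin 5)) := h ▸ Set.mem_insert _ _
    have h1 : (1 : Fin 5) ∈ ({x} : Set (Fin 5)) := h ▸ Set.mem_insert_of_mem _ rfl
    exact absurd (h0.trans h1.symm) (by decide)
  refine SimpleGraph.hasDSeq_of_step (Q := {{0} ∪ {1}, {2}, {3}, {4}}) ?_ ?_
  · rw [Set.singleton_union]
    refine SimpleGraph.Contractible.of_step (Q := {{0, 1} ∪ {2}, {3}, {4}}) ?_ ?_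
      (TwwStep.of_insert (h01 _) (by simp [h01]) (by simp))
    · refine SimpleGraph.contractible_of_ncard_le (Set.toFinite _) (Set.insert_nonempty _ _) ?_ ?_
      · ext x
        fin_cases x <;> simp
      · exact (Set.ncard_insert_le _ _).trans
          (Nat.succ_le_succ ((Set.ncard_insert_le _ _).trans (by simp)))
    · have hs := SimpleGraph.not_mixedPair_singleton_s9 (G := SimpleGraph.cycleGraph 5)
      have h3 : ¬ (SimpleGraph.cycleGraph 5).MixedPair {0, 1} {3} := by
        rw [mixedPair_pair_singleton_iff]
        simp only [Distinguishes, cycleGraph_five_adj]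
        decide
      intro A hA
      by_cases hA01 : A = {0, 1}
      · subst hA01
        refine (Set.ncard_le_ncard (t := {{2}, {4}}) ?_ (Set.toFinite _)).trans
          ((Set.ncard_insert_le _ _).trans (by simp))
        rintro B ⟨rfl | rfl | rfl | rfl, hne, hm⟩
        exacts [(hne rfl).elim, Or.inl rfl, (h3 hm).elim, Or.inr rfl]
      · obtain ⟨x, rfl⟩ : ∃ x, A = {x} := by
          rcases hA with h | h | h | h
          exacts [(hA01 h).elim, ⟨_, h⟩, ⟨_, h⟩, ⟨_, h⟩]
        refine (SimpleGraph.redDeg_le_one (Set.toFinite _) ?_).trans one_le_two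
        rintro B (rfl | rfl | rfl | rfl) C (rfl | rfl | rfl | rfl) - - hB hC
        all_goals first
          | with_reducible rfl
          | exact (hs _ _ hB).elim
          | exact (hs _ _ hC).elim
  · rw [hr]
    exact TwwStep.of_insert (by simp) (by simp) (by simp)

theorem twinWidth_cycleGraph_five : (SimpleGraph.cycleGraph 5).twinWidth = 2 := by
  refine le_antisymm (Nat.sInf_le hasDSeq_two_cycleGraph_five) ?_
  refine le_csInf ⟨2, hasDSeq_two_cycleGraph_five⟩ fun k hk => ?_
  by_contra hlt
  refine not_hasDSeq_one ?_ (k := k) (by omega) hk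
  simp only [Distinguishes, cycleGraph_five_adj]
  decide

end FiveCycle

/-- The cycle `C₅` on 5 vertices has twin-width 2, every graph on at
most 4 vertices has twin-width at most 1, and every graph on 5 vertices of twin-width 2
is isomorphic to `C₅`; hence the smallest number of vertices of a graph of twin-width 2
is 5, and `C₅` is the unique such graph up to isomorphism. -/
theorem twinWidth_number_two :
    (SimpleGraph.cycleGraph 5).twinWidth = 2 ∧
    (∀ (V : Type u) [Fintype V], ∀ G : SimpleGraph V,
      Fintype.card V ≤ 4 → G.twinWidth ≤ 1) ∧
    (∀ (V : Type u) [Fintype V], ∀ G : SimpleGraph V,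
      Fintype.card V = 5 → G.twinWidth = 2 → Nonempty (G ≃g SimpleGraph.cycleGraph 5)) := by
  refine ⟨twinWidth_cycleGraph_five, fun V _ G hV => twinWidth_le_one_of_card_le_four hV,
    fun V _ G hV htw => ?_⟩
  let f := (Fintype.equivFinOfCardEq hV).symm
  obtain ⟨a, b, c, d, e, hnd, h⟩ | ⟨a, b, c, d, e, hnd, h⟩ :=
    reducibleOrFiveCycle_of_symm (R := fun i j => G.Adj (f i) (f j)) (fun _ _ h => h.symm)
      fun _ => G.irrefl
  · obtain ⟨hnd', hcov⟩ := nodup_and_cover_of_bijective f.bijective hnd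
    have := twinWidth_le_one_of_hasDSeq (hasDSeq_one_of_reducibleOrder hnd' hcov h)
    omega
  · obtain ⟨hnd', hcov⟩ := nodup_and_cover_of_bijective f.bijective hnd
    exact nonempty_iso_cycleGraph_five hnd' hcov h
end

section
/- Every graph on at most 7 vertices has twin-width at most 2, and there exists a graph on 8 vertices of twin-width 3. In particular, the smallest number of vertices of a graph of twin-width 3 is 8. -/
universe u

/-- `G` admits a sequence of `d`-contractions starting at the partition `P`. -/
def SimpleGraph.HasDSeqFrom {V : Type*} (G : SimpleGraph V) (d : ℕ) (P : Set (Set V)) : Prop :=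
  ∃ (N : ℕ) (f : ℕ → Set (Set V)),
    f 0 = P ∧
    (∀ i < N, TwwStep (f i) (f (i + 1))) ∧
    f N = {Set.univ} ∧
    ∀ i ≤ N, ∀ A ∈ f i, G.redDeg (f i) A ≤ d

namespace TwinWidth

/-- A trigraph whose vertices are natural numbers: `some true` stands for a black edge,
`some false` for a non-edge and `none` for a red edge. -/
abbrev Trigraph := ℕ → ℕ → Option Bool

/-- The partition of `V` into the color classes of `c`. -/
def fibers {V : Type*} (c : V → ℕ) : Set (Set V) :=
  Set.range fun x => {y | c y = c x}

/-- Recolor the class of `u` by the color `v`. -/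
def merge {V : Type*} (c : V → ℕ) (u v : ℕ) (x : V) : ℕ :=
  if c x = u then v else c x

/-- Between distinct color classes of `c`, the graph `G` is as prescribed by the black edges and
non-edges of `M`, up to complementation of `G` when `s = false`. -/
def Realizes {V : Type*} (G : SimpleGraph V) (s : Bool) (c : V → ℕ) (M : Trigraph) : Prop :=
  ∀ x y, c x ≠ c y → ∀ b, M (c x) (c y) = some b → (G.Adj x y ↔ b = s)

/-- The adjacency of a contracted vertex, given the adjacencies of the two vertices. -/
def meet : Option Bool → Option Bool → Option Bool
  | some true, some true => some true
  | some false, some false => some false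
  | _, _ => none

/-- Contract `u` into `v`. The vertex `u` is not removed, but plays no role afterwards. -/
def contract (M : Trigraph) (u v : ℕ) : Trigraph := fun i j =>
  bif i.beq v then meet (M u j) (M v j)
  else bif j.beq v then meet (M i u) (M i v) else M i j

/-- The number of red neighbors of `i` among the vertices in `l`. -/
def reds (M : Trigraph) (l : List ℕ) (i : ℕ) : ℕ :=
  l.countP fun j => !(i.beq j) && (M i j).isNone

/-- Is there a sequence of `k` contractions with red degrees at most `d` which leaves at most
`d + 2` vertices of the trigraph `M` on the vertices in `l`? -/
def search (d : ℕ) : ℕ → List ℕ → Trigraph → Bool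
  | 0, l, _ => l.length.ble (d + 2)
  | k + 1, l, M => l.any fun v => l.any fun u => v.blt u &&
      ((l.erase u).all fun i => (reds (contract M u v) (l.erase u) i).ble d) &&
        search d k (l.erase u) (contract M u v)

/-- Make `a` and `b` joined by a black edge or not adjacent. -/
def setPair (M : Trigraph) (a b : ℕ) (t : Bool) : Trigraph := fun i j =>
  bif (i.beq a && j.beq b) || (i.beq b && j.beq a) then some t else M i j

/-- Test `p` for all ways to specify the adjacencies of the pairs in a list. -/
def forallPairs (p : Trigraph → Bool) : List (ℕ × ℕ) → Trigraph → Bool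
  | [], M => p M
  | q :: l, M => forallPairs p l (setPair M q.1 q.2 true) &&
      forallPairs p l (setPair M q.1 q.2 false)

section Sequences

variable {V : Type*} {G : SimpleGraph V} {d : ℕ}

lemma hasDSeqFrom_univ : G.HasDSeqFrom d {Set.univ} := by
  refine ⟨0, fun _ => {Set.univ}, rfl, by simp, rfl, ?_⟩
  rintro i - A rfl
  have h : {Q ∈ ({Set.univ} : Set (Set V)) | Q ≠ Set.univ ∧ G.MixedPair Set.univ Q} = ∅ :=
    Set.eq_empty_of_forall_notMem fun Q hQ => hQ.2.1 hQ.1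
  rw [SimpleGraph.redDeg, h, Set.ncard_empty]
  exact d.zero_le

lemma hasDSeqFrom_of_step {P Q : Set (Set V)} (hP : ∀ A ∈ P, G.redDeg P A ≤ d)
    (h : TwwStep P Q) (hQ : G.HasDSeqFrom d Q) : G.HasDSeqFrom d P := by
  obtain ⟨N, f, rfl, hs, hN, hd⟩ := hQ
  refine ⟨N + 1, fun i => Nat.casesOn i P f, rfl, ?_, hN, ?_⟩
  · rintro (_ | i) hi
    · exact h
    · exact hs i (by omega)
  · rintro (_ | i) hi
    · exact hP
    · exact hd i (by omega)

lemma twwStep_fibers_merge {c : V → ℕ} {x y : V} (h : c x ≠ c y) :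
    TwwStep (fibers c) (fibers (merge c (c x) (c y))) := by
  have hne {z w : V} (hzw : c z ≠ c w) : {t | c t = c z} ≠ {t | c t = c w} := fun h' =>
    hzw (h'.subset (show c z = c z from rfl))
  refine ⟨{z | c z = c x}, ⟨x, rfl⟩, {z | c z = c y}, ⟨y, rfl⟩, hne h, ?_⟩
  have hxy : {z | c z = c x} ∪ {z | c z = c y} = {z | merge c (c x) (c y) z = c y} := by
    ext z
    simp only [merge, Set.mem_union, Set.mem_ofPred_eq]
    split_ifs <;> simp_all
  have hother {z : V} (hzx : c z ≠ c x) (hzy : c z ≠ c y) :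
      {w | merge c (c x) (c y) w = merge c (c x) (c y) z} = {w | c w = c z} := by
    ext w
    simp only [merge, Set.mem_ofPred_eq]
    grind
  have hboth {z : V} (hz : c z = c x ∨ c z = c y) : merge c (c x) (c y) z = c y := by
    simp only [merge]
    grind
  ext A
  rw [hxy]
  constructor
  · rintro ⟨z, rfl⟩
    by_cases hz : c z = c x ∨ c z = c y
    · left
      simp only [hboth hz]
    · push Not at hz
      right
      simp only [hother hz.1 hz.2]
      exact ⟨⟨z, rfl⟩, by simp [hne hz.1, hne hz.2]⟩
  · rintro (rfl | ⟨⟨z, rfl⟩, hz⟩)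
    · exact ⟨y, by simp only [hboth (.inr rfl)]⟩
    · refine ⟨z, hother ?_ ?_⟩ <;> intro hz' <;> simp [hz'] at hz

lemma hasDSeqFrom_of_merge {c : V → ℕ} {u v : ℕ} (huv : u ≠ v)
    (hc : ∀ A ∈ fibers c, G.redDeg (fibers c) A ≤ d)
    (h : G.HasDSeqFrom d (fibers (merge c u v))) : G.HasDSeqFrom d (fibers c) := by
  by_cases hu : ∃ x, c x = u
  · by_cases hv : ∃ y, c y = v
    · obtain ⟨x, rfl⟩ := hu
      obtain ⟨y, rfl⟩ := hv
      exact hasDSeqFrom_of_step hc (twwStep_fibers_merge huv) h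
    · push Not at hv
      convert h using 1
      simp only [fibers]
      congr! 3 with x
      ext y
      have := hv x
      have := hv y
      simp only [merge]
      grind
  · push Not at hu
    convert h using 2
    ext x
    simp [merge, hu x]

lemma redDeg_fibers_le {s : Bool} {c : V → ℕ} {M : Trigraph} {l : List ℕ}
    (hM : Realizes G s c M) (hl : ∀ x, c x ∈ l) (x : V) :
    G.redDeg (fibers c) {y | c y = c x} ≤ reds M l (c x) := by
  classical
  let L := l.filter fun j => !((c x).beq j) && (M (c x) j).isNone
  have hsub : {Q ∈ fibers c | Q ≠ {y | c y = c x} ∧ G.MixedPair {y | c y = c x} Q} ⊆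
      (L.toFinset.image fun j => {z | c z = j} : Finset (Set V)) := by
    rintro _ ⟨⟨y, rfl⟩, hne, hmix⟩
    have hxy : c x ≠ c y := fun h => hne (by simp only [h])
    refine Finset.mem_coe.2 (Finset.mem_image.2 ⟨c y, ?_, rfl⟩)
    rw [List.mem_toFinset, List.mem_filter]
    refine ⟨hl y, ?_⟩
    cases hb : M (c x) (c y) with
    | none => simpa [← Bool.not_eq_true] using hxy
    | some b =>
      have key (z) (hz : c z = c x) (w) (hw : c w = c y) : G.Adj z w ↔ b = s :=
        hM z w (by rwa [hz, hw]) b (by rwa [hz, hw])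
      by_cases hbs : b = s
      · exact absurd (fun z hz w hw => (key z hz w hw).2 hbs) hmix.1
      · exact absurd (fun z hz w hw h => hbs ((key z hz w hw).1 h)) hmix.2
  calc G.redDeg (fibers c) {y | c y = c x}
      ≤ (L.toFinset.image fun j => {z | c z = j}).card := by
        rw [← Set.ncard_coe_finset]
        exact Set.ncard_le_ncard hsub (Finset.finite_toSet _)
    _ ≤ L.toFinset.card := Finset.card_image_le
    _ ≤ L.length := L.toFinset_card_le
    _ = reds M l (c x) := (List.countP_eq_length_filter ..).symm

lemma redDeg_fibers_lt {c : V → ℕ} {l : List ℕ} (hl : ∀ x, c x ∈ l) (x : V) :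
    G.redDeg (fibers c) {y | c y = c x} < l.length := by
  have hM : Realizes G true c fun _ _ => none := by simp [Realizes]
  refine (redDeg_fibers_le hM hl x).trans_lt ?_
  refine List.countP_le_length.lt_of_ne fun h => ?_
  simpa using List.countP_eq_length.1 h _ (hl x)

lemma merge_mem {c : V → ℕ} {l l' : List ℕ} {u v : ℕ} (hv : v ∈ l')
    (h : ∀ w ∈ l, w ≠ u → w ∈ l') (hl : ∀ x, c x ∈ l) (x : V) : merge c u v x ∈ l' := by
  unfold merge
  split_ifs with hx
  · exact hv
  · exact h _ (hl x) hx

lemma hasDSeqFrom_of_length_le [Nonempty V] (l : List ℕ) (c : V → ℕ) (hl : ∀ x, c x ∈ l)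
    (hd : l.length ≤ d + 1) : G.HasDSeqFrom d (fibers c) := by
  induction l generalizing c with
  | nil => simp at hl
  | cons u l ih =>
    cases l with
    | nil =>
      have : fibers c = {Set.univ} := by
        simp only [List.mem_singleton] at hl
        simp [fibers, hl]
      exact this ▸ hasDSeqFrom_univ
    | cons v l =>
      by_cases huv : u = v
      · exact ih c (fun x => by simpa [huv] using hl x) (by simp at hd ⊢; omega)
      · refine hasDSeqFrom_of_merge huv ?_
          (ih _ (merge_mem (by simp) (by simp +contextual) hl) (by simp at hd ⊢; omega))
        rintro _ ⟨x, rfl⟩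
        exact Nat.le_of_lt_succ ((redDeg_fibers_lt hl x).trans_le hd)

lemma hasDSeqFrom_of_length_le_add_two [Nonempty V] {l : List ℕ} {c : V → ℕ}
    (hl : ∀ x, c x ∈ l) (hc : ∀ A ∈ fibers c, G.redDeg (fibers c) A ≤ d)
    (hd : l.length ≤ d + 2) : G.HasDSeqFrom d (fibers c) := by
  match l with
  | [] | [_] => exact hasDSeqFrom_of_length_le _ c hl (by simp)
  | u :: v :: l =>
    by_cases huv : u = v
    · exact hasDSeqFrom_of_length_le (v :: l) c (fun x => by simpa [huv] using hl x)
        (by simp at hd ⊢; omega)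
    · exact hasDSeqFrom_of_merge huv hc (hasDSeqFrom_of_length_le (v :: l) _
        (merge_mem (by simp) (by simp +contextual) hl) (by simp at hd ⊢; omega))

lemma meet_eq_some {a b : Option Bool} {t : Bool} (h : meet a b = some t) :
    a = some t ∧ b = some t := by
  revert a b t
  decide

lemma Realizes.contract {s : Bool} {c : V → ℕ} {M : Trigraph} (hM : Realizes G s c M) (u v : ℕ) :
    Realizes G s (merge c u v) (contract M u v) := by
  intro x y hxy b hb
  have hcol (z : V) : merge c u v z = v ∧ (c z = u ∨ c z = v) ∨
      merge c u v z ≠ v ∧ merge c u v z = c z := by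
    unfold merge
    grind
  rcases hcol x with ⟨hx, hx'⟩ | ⟨hx, hx'⟩ <;> rcases hcol y with ⟨hy, hy'⟩ | ⟨hy, hy'⟩
  · exact absurd (hx.trans hy.symm) hxy
  all_goals
    simp only [TwinWidth.contract, cond_eq_ite, Nat.beq_eq, hx, hy, if_true,
      if_false] at hb
  · have := meet_eq_some hb
    refine hM x y ?_ b ?_
    · rcases hx' with h | h <;> grind [merge]
    · rcases hx' with h | h <;> grind
  · have := meet_eq_some hb
    refine hM x y ?_ b ?_
    · rcases hy' with h | h <;> grind [merge]
    · rcases hy' with h | h <;> grind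
  · exact hM x y (by grind) b (by grind)

lemma hasDSeqFrom_of_search [Nonempty V] {s : Bool} (k : ℕ) {l : List ℕ} {M : Trigraph}
    {c : V → ℕ} (hM : Realizes G s c M) (hl : ∀ x, c x ∈ l)
    (hc : ∀ A ∈ fibers c, G.redDeg (fibers c) A ≤ d) (h : search d k l M = true) :
    G.HasDSeqFrom d (fibers c) := by
  induction k generalizing l M c with
  | zero => exact hasDSeqFrom_of_length_le_add_two hl hc (by simpa [search] using h)
  | succ k ih =>
    simp only [search, List.any_eq_true, Bool.and_eq_true, List.all_eq_true,
      Nat.ble_eq] at h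
    obtain ⟨v, hv, u, hu, ⟨hlt, hred⟩, hrec⟩ := h
    have hvu : v < u := by simpa [Nat.blt] using hlt
    have hl' : ∀ x, merge c u v x ∈ l.erase u :=
      merge_mem ((List.mem_erase_of_ne hvu.ne).2 hv)
        (fun w hw hwu => (List.mem_erase_of_ne hwu).2 hw) hl
    refine hasDSeqFrom_of_merge hvu.ne' hc (ih (hM.contract u v) hl' ?_ hrec)
    rintro _ ⟨x, rfl⟩
    exact (redDeg_fibers_le (hM.contract u v) hl' x).trans (hred _ (hl' x))

/-- The graph `G` is complete or anticomplete between the color classes `i` and `j` of `c`. -/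
def Homogeneous (G : SimpleGraph V) (c : V → ℕ) (i j : ℕ) : Prop :=
  ∃ t : Bool, ∀ x y, c x = i → c y = j → (G.Adj x y ↔ t = true)

lemma Homogeneous.symm {c : V → ℕ} {i j : ℕ} (h : Homogeneous G c i j) :
    Homogeneous G c j i :=
  h.imp fun _ ht x y hx hy => by rw [G.adj_comm, ht y x hy hx]

lemma Realizes.setPair {s t : Bool} {c : V → ℕ} {M : Trigraph} {i j : ℕ}
    (hM : Realizes G s c M) (h : ∀ x y, c x = i → c y = j → (G.Adj x y ↔ t = s)) :
    Realizes G s c (setPair M i j t) := by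
  intro x y hxy b hb
  simp only [TwinWidth.setPair, cond_eq_ite, Bool.or_eq_true, Bool.and_eq_true, Nat.beq_eq] at hb
  split_ifs at hb with hij
  · obtain rfl : t = b := by simpa using hb
    rcases hij with ⟨hx, hy⟩ | ⟨hx, hy⟩
    · exact h x y hx hy
    · rw [G.adj_comm]
      exact h y x hy hx
  · exact hM x y hxy b hb

lemma exists_realizes_of_forallPairs {s : Bool} {c : V → ℕ} {p : Trigraph → Bool}
    {l : List (ℕ × ℕ)} {M : Trigraph} (hM : Realizes G s c M)
    (hl : ∀ q ∈ l, Homogeneous G c q.1 q.2) (h : forallPairs p l M = true) :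
    ∃ M', Realizes G s c M' ∧ p M' = true := by
  induction l generalizing M with
  | nil => exact ⟨M, hM, h⟩
  | cons q l ih =>
    simp only [forallPairs, Bool.and_eq_true] at h
    obtain ⟨t, ht⟩ := hl q (by simp)
    have hset : Realizes G s c (TwinWidth.setPair M q.1 q.2 (t == s)) :=
      hM.setPair fun x y hx hy => by rw [ht x y hx hy]; cases s <;> cases t <;> decide
    refine ih hset (fun q' hq' => hl q' (by simp [hq'])) ?_
    cases (t == s)
    exacts [h.2, h.1]

end Sequences

section SevenVertices

/-- Every trigraph on six vertices whose red edges form a path on three vertices with center `0`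
and ends `1` and `2`, and in which `0` and `5` are not adjacent, admits two contractions which
keep the red degree at most two. Adjacencies are branched on only where needed. -/
lemma forallPairs_search : forallPairs
    (fun M => search 2 2 [0, 1, 2, 3, 4, 5] M ||
      forallPairs (search 2 2 [0, 1, 2, 3, 4, 5]) [(2, 3), (0, 3), (1, 3), (4, 5), (1, 2)] M)
    [(1, 4), (3, 4), (1, 5), (3, 5), (2, 4), (2, 5), (0, 4)]
    (setPair (fun _ _ => none) 0 5 false) = true := by
  decide +kernel

lemma exists_pair_card_le_two (H : SimpleGraph (Fin 7)) [DecidableRel H.Adj] :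
    ∃ u v, u ≠ v ∧
      (Finset.univ.filter fun w => w ≠ u ∧ w ≠ v ∧ ¬ (H.Adj u w ↔ H.Adj v w)).card ≤ 2 := by
  by_contra hcon
  let a (u w : Fin 7) : ℤ := if H.Adj u w then 1 else 0
  let δ (w u v : Fin 7) : ℤ := if w ≠ u ∧ w ≠ v ∧ ¬ (H.Adj u w ↔ H.Adj v w) then 1 else 0
  have hδ (w u v : Fin 7) : δ w u v =
      if u ≠ w then (if v ≠ w then a u w + a v w - 2 * a u w * a v w else 0) else 0 := by
    simp only [δ, a]
    split_ifs <;> grind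
  have hdeg (w : Fin 7) : ∑ u ∈ Finset.univ.filter (· ≠ w), a u w = H.degree w := by
    rw [← H.card_neighborFinset_eq_degree, Finset.card_eq_sum_ones, Finset.sum_filter]
    push_cast
    rw [H.neighborFinset_eq_filter, Finset.sum_filter]
    refine Finset.sum_congr rfl fun u _ => ?_
    simp only [a, H.adj_comm w u]
    have := fun h : H.Adj u w => h.ne
    split_ifs <;> simp_all
  have hsum (w : Fin 7) : ∑ u, ∑ v, δ w u v = 12 * H.degree w - 2 * (H.degree w : ℤ) ^ 2 := by
    have hcard : ((Finset.univ.filter (· ≠ w)).card : ℤ) = 6 := by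
      rw [Finset.filter_ne', Finset.card_erase_of_mem (Finset.mem_univ w)]
      rfl
    calc ∑ u, ∑ v, δ w u v
        = ∑ u ∈ Finset.univ.filter (· ≠ w), ∑ v ∈ Finset.univ.filter (· ≠ w),
            (a u w + a v w - 2 * a u w * a v w) := by
          simp only [Finset.sum_filter (· ≠ w), hδ]
          refine Finset.sum_congr rfl fun u _ => ?_
          split_ifs <;> simp
      _ = _ := by
          simp only [Finset.sum_sub_distrib, Finset.sum_add_distrib, Finset.sum_const,
            ← Finset.mul_sum, ← Finset.sum_mul, nsmul_eq_mul, hcard, hdeg]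
          ring
  have hpair (u v : Fin 7) : (if u ≠ v then 3 else 0) ≤ ∑ w, δ w u v := by
    have h : ∑ w, δ w u v =
        ((Finset.univ.filter fun w => w ≠ u ∧ w ≠ v ∧ ¬ (H.Adj u w ↔ H.Adj v w)).card : ℤ) := by
      simp only [δ, Finset.card_eq_sum_ones, Finset.sum_filter]
      push_cast
      rfl
    rw [h]
    split_ifs with huv
    · exact Nat.ofNat_le_cast.2 (Nat.lt_of_not_le fun h => hcon ⟨u, v, huv, h⟩)
    · positivity
  have htotal : (126 : ℤ) ≤ ∑ w, (12 * H.degree w - 2 * (H.degree w : ℤ) ^ 2) :=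
    calc (126 : ℤ) = ∑ u : Fin 7, ∑ v : Fin 7, if u ≠ v then 3 else 0 := by decide
      _ ≤ ∑ u, ∑ v, ∑ w, δ w u v :=
        Finset.sum_le_sum fun u _ => Finset.sum_le_sum fun v _ => hpair u v
      _ = ∑ w, ∑ u, ∑ v, δ w u v :=
        (Finset.sum_congr rfl fun _ _ => Finset.sum_comm).trans Finset.sum_comm
      _ = _ := Finset.sum_congr rfl fun w _ => hsum w
  have hsq : ∑ w, ((H.degree w : ℤ) - 3) ^ 2 ≤ 0 := by
    have h : ∑ w, (12 * H.degree w - 2 * (H.degree w : ℤ) ^ 2) =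
        126 - 2 * ∑ w, ((H.degree w : ℤ) - 3) ^ 2 := by
      rw [Finset.mul_sum, show (126 : ℤ) = ∑ _w : Fin 7, 18 by simp, ← Finset.sum_sub_distrib]
      exact Finset.sum_congr rfl fun w _ => by ring
    linarith
  have hthree (w : Fin 7) : H.degree w = 3 := by
    have h := (Finset.single_le_sum (f := fun w => ((H.degree w : ℤ) - 3) ^ 2)
      (fun w _ => sq_nonneg _) (Finset.mem_univ w)).trans hsq
    have := pow_eq_zero_iff (two_ne_zero) |>.1 (le_antisymm h (sq_nonneg _))
    omega
  have := H.sum_degrees_eq_twice_card_edges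
  simp only [hthree, Finset.sum_const, Finset.card_univ, Fintype.card_fin, smul_eq_mul] at this
  omega

lemma exists_perm_adj_iff (H : SimpleGraph (Fin 7)) :
    ∃ σ : Fin 7 ≃ Fin 7, ∀ w, 3 ≤ w → w < 6 → (H.Adj (σ 0) (σ w) ↔ H.Adj (σ 6) (σ w)) := by
  classical
  obtain ⟨u, v, huv, hcard⟩ := exists_pair_card_le_two H
  set D := Finset.univ.filter fun w => w ≠ u ∧ w ≠ v ∧ ¬ (H.Adj u w ↔ H.Adj v w) with hD
  obtain ⟨S, hDS, hS, hS2⟩ : ∃ S, D ⊆ S ∧ S ⊆ ({u, v} : Finset (Fin 7))ᶜ ∧ S.card = 2 := by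
    refine Finset.exists_subsuperset_card_eq ?_ hcard ?_
    · intro w
      simp +contextual [hD]
    · rw [Finset.card_compl, Finset.card_pair huv, Fintype.card_fin]
      norm_num
  obtain ⟨a, b, hab, rfl⟩ := Finset.card_eq_two.1 hS2
  have hT : (({u, v} ∪ {a, b} : Finset (Fin 7))ᶜ).card = 3 := by
    rw [Finset.card_compl, Finset.card_union_of_disjoint, Finset.card_pair huv,
      Finset.card_pair hab]
    · simp
    · exact (Finset.subset_compl_iff_disjoint_left).1 hS
  obtain ⟨p, q, r, -, -, -, hT⟩ := Finset.card_eq_three.1 hT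
  have hmem (w : Fin 7) : (w = p ∨ w = q ∨ w = r) ↔ ¬ ((w = u ∨ w = v) ∨ w = a ∨ w = b) := by
    have := Finset.ext_iff.1 hT w
    simp only [Finset.mem_compl, Finset.mem_union, Finset.mem_insert, Finset.mem_singleton] at this
    exact this.symm
  have hsurj : Function.Surjective ![u, a, b, p, q, r, v] := by
    intro w
    by_contra! hw
    have := (hmem w).not
    have h0 := hw 0
    have h1 := hw 1
    have h2 := hw 2
    have h3 := hw 3
    have h4 := hw 4
    have h5 := hw 5
    have h6 := hw 6
    simp only [Matrix.cons_val] at h0 h1 h2 h3 h4 h5 h6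
    grind
  refine ⟨Equiv.ofBijective _ (Finite.surjective_iff_bijective.1 hsurj), fun w h3 h6 => ?_⟩
  have hw : ![u, a, b, p, q, r, v] w = p ∨ ![u, a, b, p, q, r, v] w = q ∨
      ![u, a, b, p, q, r, v] w = r := by
    fin_cases w <;> simp_all
  simp only [Equiv.ofBijective_apply]
  generalize ![u, a, b, p, q, r, v] w = z at hw
  have hz := (hmem z).1 hw
  have hzD : z ∉ D := fun h => hz (.inr (by simpa using hDS h))
  change H.Adj u z ↔ H.Adj v z
  simp only [hD, Finset.mem_filter] at hzD
  grind

lemma homogeneous_of_colors {V : Type*} {G : SimpleGraph V} {H : SimpleGraph (Fin 7)}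
    {κ : V → Fin 7} (hG : ∀ x y, G.Adj x y ↔ H.Adj (κ x) (κ y))
    (hH : ∀ w, 3 ≤ w → w < 6 → (H.Adj 0 w ↔ H.Adj 6 w)) {i j : ℕ} (hij : i < j) (hj : j < 6)
    (h0 : i = 0 → 3 ≤ j) : Homogeneous G (merge (fun x => (κ x : ℕ)) 6 0) i j := by
  classical
  refine ⟨decide (H.Adj ⟨i, by omega⟩ ⟨j, by omega⟩), fun x y hx hy => ?_⟩
  rw [hG, decide_eq_true_eq]
  have hy' : κ y = ⟨j, by omega⟩ := by
    ext
    simp only [merge] at hy ⊢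
    grind
  have hx' : κ x = ⟨i, by omega⟩ ∨ i = 0 ∧ κ x = 6 := by
    simp only [merge] at hx
    grind
  rw [hy']
  rcases hx' with hx' | ⟨rfl, hx'⟩
  · rw [hx']
  · rw [hx']
    exact (hH _ (h0 rfl) hj).symm

lemma fibers_of_injective {V : Type*} {c : V → ℕ} (hc : Function.Injective c) :
    fibers c = Set.range fun v => ({v} : Set V) := by
  unfold fibers
  congr! 2 with x
  ext y
  exact hc.eq_iff

lemma redDeg_fibers_of_injective {V : Type*} (G : SimpleGraph V) {c : V → ℕ}
    (hc : Function.Injective c) (A : Set V) (hA : A ∈ fibers c) :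
    G.redDeg (fibers c) A = 0 := by
  rw [fibers_of_injective hc] at hA ⊢
  obtain ⟨x, rfl⟩ := hA
  suffices h : {Q ∈ Set.range fun v => ({v} : Set V) | Q ≠ {x} ∧ G.MixedPair {x} Q} = ∅ by
    rw [SimpleGraph.redDeg, h, Set.ncard_empty]
  refine Set.eq_empty_of_forall_notMem ?_
  rintro _ ⟨⟨y, rfl⟩, -, h1, h2⟩
  simp_all

lemma hasDSeq_two {V : Type*} [Fintype V] [Nonempty V] (G : SimpleGraph V)
    (hV : Fintype.card V ≤ 7) : G.HasDSeq 2 := by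
  obtain ⟨e⟩ : Nonempty (V ↪ Fin 7) := Function.Embedding.nonempty_of_card_le (by simpa using hV)
  obtain ⟨σ, hσ⟩ := exists_perm_adj_iff (G.map e)
  let κ : V → Fin 7 := fun x => σ.symm (e x)
  let H : SimpleGraph (Fin 7) := (G.map e).comap σ
  have hG (x y : V) : G.Adj x y ↔ H.Adj (κ x) (κ y) := by simp [H, κ]
  have hinj : Function.Injective fun x => (κ x : ℕ) := fun x y h => by
    simpa [κ] using Fin.val_injective h
  have hhom {i j : ℕ} : i < j → j < 6 → (i = 0 → 3 ≤ j) → _ :=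
    homogeneous_of_colors (i := i) (j := j) hG hσ
  change G.HasDSeqFrom 2 _
  rw [← fibers_of_injective hinj]
  refine hasDSeqFrom_of_merge (u := 6) (v := 0) (by decide)
    (fun A hA => (redDeg_fibers_of_injective G hinj A hA).trans_le zero_le_two) ?_
  set c := merge (fun x => (κ x : ℕ)) 6 0
  have hl (x : V) : c x ∈ [0, 1, 2, 3, 4, 5] := by
    simp only [c, merge]
    have := (κ x).isLt
    split_ifs
    · simp
    · simp
      omega
  have hc : ∀ A ∈ fibers c, G.redDeg (fibers c) A ≤ 2 := by
    classical
    let M : Trigraph := fun i j => if h : Homogeneous G c i j then some h.choose else none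
    have hM : Realizes G true c M := fun x y _ b hb => by
      simp only [M] at hb
      split_ifs at hb with h
      rw [h.choose_spec x y rfl rfl, Option.some_injective _ hb]
    have hnone {i j : ℕ} (hi : i ∈ [0, 1, 2, 3, 4, 5]) (hj : j ∈ [0, 1, 2, 3, 4, 5])
        (hred : (!(i.beq j) && (M i j).isNone) = true) :
        decide (i = 0 ∧ j < 3 ∧ j ≠ 0 ∨ j = 0 ∧ i < 3 ∧ i ≠ 0) = true := by
      have hij : ¬ Homogeneous G c i j := fun h => by simp [M, h] at hred
      have hne : i ≠ j := fun h => by simp [h] at hred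
      rw [decide_eq_true_eq]
      by_contra hcon
      rcases hne.lt_or_gt with hlt | hlt
      · exact hij (hhom hlt (by simp at hj; omega) (by omega))
      · exact hij (hhom hlt (by simp at hi; omega) (by omega)).symm
    rintro _ ⟨x, rfl⟩
    refine (redDeg_fibers_le hM hl x).trans
      ((List.countP_mono_left fun j hj => hnone (hl x) hj).trans ?_)
    have hx := hl x
    generalize c x = i at hx
    revert i
    decide
  have hpairs {l : List (ℕ × ℕ)} (h : ∀ q ∈ l, q.1 < q.2 ∧ q.2 < 6 ∧ (q.1 = 0 → 3 ≤ q.2)) :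
      ∀ q ∈ l, Homogeneous G c q.1 q.2 := fun q hq =>
    hhom (h q hq).1 (h q hq).2.1 (h q hq).2.2
  obtain ⟨t, ht⟩ := hhom (i := 0) (j := 5) (by decide) (by decide) (by decide)
  have hnone : Realizes G (!t) c fun _ _ => none := by simp [Realizes]
  obtain ⟨M, hM, hs⟩ := exists_realizes_of_forallPairs
    (hnone.setPair (i := 0) (j := 5) (t := false) (by simpa using ht))
    (hpairs (by decide)) forallPairs_search
  rw [Bool.or_eq_true] at hs
  rcases hs with hs | hs
  · exact hasDSeqFrom_of_search 2 hM hl hc hs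
  · obtain ⟨M, hM, hs⟩ := exists_realizes_of_forallPairs hM (hpairs (by decide)) hs
    exact hasDSeqFrom_of_search 2 hM hl hc hs

lemma twinWidth_le_two {V : Type*} [Fintype V] (G : SimpleGraph V)
    (hV : Fintype.card V ≤ 7) : G.twinWidth ≤ 2 := by
  cases isEmpty_or_nonempty V
  · rw [SimpleGraph.twinWidth, Set.eq_empty_of_forall_notMem (s := {d | G.HasDSeq d})]
    · simp
    · rintro d ⟨_ | N, f, h0, hs, hN, -⟩
      · rw [h0, Set.range_eq_empty] at hN
        exact Set.singleton_ne_empty _ hN.symm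
      · obtain ⟨A, hA, -⟩ := hs 0 N.succ_pos
        simp [h0] at hA
  · exact Nat.sInf_le (hasDSeq_two G hV)

end SevenVertices

section EightVertices

/-- The relation of lying on a common row or column of the `3 × 3` grid whose cells are numbered
`0, …, 8` row by row. -/
def sameLine (i j : ℕ) : Bool :=
  (i / 3).beq (j / 3) || (i % 3).beq (j % 3)

/-- The `3 × 3` rook's graph (which is the Paley graph on nine vertices) with a vertex removed. -/
def puncturedRook : SimpleGraph (Fin 8) where
  Adj x y := x ≠ y ∧ sameLine x y = true
  symm := ⟨by decide⟩
  loopless := ⟨by decide⟩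

instance : DecidableRel puncturedRook.Adj := fun x y =>
  inferInstanceAs (Decidable (x ≠ y ∧ sameLine x y = true))

lemma three_le_card_of_ne : ∀ u v : Fin 8, u ≠ v → 3 ≤ (Finset.univ.filter fun w =>
    w ≠ u ∧ w ≠ v ∧ ¬ (puncturedRook.Adj u w ↔ puncturedRook.Adj v w)).card := by
  decide

lemma three_le_of_hasDSeq {d : ℕ} (h : puncturedRook.HasDSeq d) : 3 ≤ d := by
  obtain ⟨N, f, h0, hs, hN, hd⟩ := h
  have hpos : 0 < N := by
    rcases N.eq_zero_or_pos with rfl | hpos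
    · have hmem : ({0} : Set (Fin 8)) ∈ f 0 := h0 ▸ ⟨0, rfl⟩
      rw [hN, Set.mem_singleton_iff] at hmem
      exact absurd (hmem ▸ Set.mem_univ (1 : Fin 8)) (by decide)
    · exact hpos
  obtain ⟨_, hA, _, hB, hne, h1⟩ := hs 0 hpos
  rw [h0] at hA hB h1
  obtain ⟨u, rfl⟩ := hA
  obtain ⟨v, rfl⟩ := hB
  have huv : u ≠ v := fun h => hne (h ▸ rfl)
  refine le_trans ?_ (hd 1 hpos ({u} ∪ {v}) (h1 ▸ Set.mem_insert _ _))
  refine (three_le_card_of_ne u v huv).trans ?_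
  rw [← Finset.card_image_of_injective _ Set.singleton_injective, ← Set.ncard_coe_finset]
  refine Set.ncard_le_ncard ?_ (Set.toFinite _)
  intro Q hQ
  obtain ⟨w, hw, rfl⟩ := Finset.mem_image.1 (Finset.mem_coe.1 hQ)
  obtain ⟨hwu, hwv, hw⟩ := (Finset.mem_filter.1 hw).2
  have hnotin {z : Fin 8} (hz : w ≠ z) : ({w} : Set (Fin 8)) ≠ {z} := by simpa using hz
  refine ⟨h1 ▸ .inr ⟨⟨w, rfl⟩, by simp [hwu, hwv]⟩, ?_, ?_⟩
  · intro h
    have : u ∈ ({w} : Set (Fin 8)) := h ▸ .inl rfl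
    exact hwu this.symm
  · simp only [SimpleGraph.MixedPair, Set.mem_union, Set.mem_singleton_iff]
    grind

lemma search_puncturedRook :
    search 3 3 [0, 1, 2, 3, 4, 5, 6, 7] (fun i j => some (sameLine i j)) = true := by
  decide +kernel

lemma hasDSeq_puncturedRook : puncturedRook.HasDSeq 3 := by
  have hinj : Function.Injective fun x : Fin 8 => (x : ℕ) := Fin.val_injective
  change puncturedRook.HasDSeqFrom 3 _
  rw [← fibers_of_injective hinj]
  refine hasDSeqFrom_of_search (s := true) 3 ?_ ?_
    (fun A hA => (redDeg_fibers_of_injective _ hinj A hA).trans_le (Nat.zero_le 3))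
    search_puncturedRook
  · rintro x y hxy b hb
    rw [← Option.some_injective _ hb]
    exact and_iff_right (fun h => hxy (h ▸ rfl))
  · decide

lemma twinWidth_puncturedRook : puncturedRook.twinWidth = 3 :=
  le_antisymm (Nat.sInf_le hasDSeq_puncturedRook)
    (le_csInf ⟨3, hasDSeq_puncturedRook⟩ fun _ => three_le_of_hasDSeq)

end EightVertices

end TwinWidth

/-- Every graph on at most 7 vertices has twin-width at most 2, and
there exists a graph on 8 vertices of twin-width 3; hence the smallest number of
vertices of a graph of twin-width 3 is 8. -/
theorem twinWidth_number_three :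
    (∀ (V : Type u) [Fintype V], ∀ G : SimpleGraph V,
      Fintype.card V ≤ 7 → G.twinWidth ≤ 2) ∧
    (∃ G : SimpleGraph (Fin 8), G.twinWidth = 3) :=
  ⟨fun _ _ G hV => TwinWidth.twinWidth_le_two G hV,
    TwinWidth.puncturedRook, TwinWidth.twinWidth_puncturedRook⟩
end
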